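/- Let b > 0, let c₁ : [−b,b] → ℝ be continuous with c₁(r) > 0 for all r, and let g : [−b,b] → ℝ be continuous with g(r) ≥ 0 for all r and g(0) > 0. Then there exist r₀ ∈ (0,b), δ > 0, and a continuously differentiable function h : [−b,b] → ℝ with h(−b) = h(b) = 0, such that for every continuous F : [−b,b] → ℝ satisfying F(r)² ≥ 1 for all |r| ≤ r₀ and F(r)² ≤ δ for all r₀ ≤ |r| ≤ b, one has ∫_{−b}^{b} F(r)² c₁(r) [ g(r) h(r)² − c₁(r)² h'(r)² ] dr > 0. -/

import Mathlib

open intervalIntegral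

/-- For `r₁ < r₀` the two conditions on `F` are compatible for every `δ`, and a smooth bump function
equal to `1` on `[-r₀, r₀]` and vanishing at `±b` serves as the test function. -/
theorem exists_bump_integral_pos {b r₁ r₀ : ℝ} (hr₁ : 0 < r₁) (hr : r₁ < r₀) (hr₀ : r₀ < b)
    {c g : ℝ → ℝ} (hc : ContinuousOn c (Set.Icc (-b) b)) (hcpos : ∀ r ∈ Set.Icc (-b) b, 0 < c r)
    (hg : ContinuousOn g (Set.Icc (-b) b)) (hgnonneg : ∀ r ∈ Set.Icc (-b) b, 0 ≤ g r)
    (hg0 : 0 < g 0) :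
    ∃ δ > (0 : ℝ), ∃ h : ℝ → ℝ,
      ContDiffOn ℝ 1 h (Set.Icc (-b) b) ∧ h (-b) = 0 ∧ h b = 0 ∧
      ∀ F : ℝ → ℝ, ContinuousOn F (Set.Icc (-b) b) →
        (∀ r : ℝ, |r| ≤ r₁ → 1 ≤ F r ^ 2) →
        (∀ r : ℝ, r₀ ≤ |r| → |r| ≤ b → F r ^ 2 ≤ δ) →
        0 < ∫ r in (-b)..b,
              F r ^ 2 * c r *
                (g r * h r ^ 2 - c r ^ 2 * (derivWithin h (Set.Icc (-b) b) r) ^ 2) := by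
  have hb : -b < b := by linarith
  let h : ContDiffBump (0 : ℝ) := ⟨r₀, b, hr₁.trans hr, hr₀⟩
  have hh : ContDiffOn ℝ 1 h (Set.Icc (-b) b) := h.contDiff.contDiffOn
  set D := derivWithin h (Set.Icc (-b) b)
  have hD : ContinuousOn D (Set.Icc (-b) b) :=
    hh.continuousOn_derivWithin (uniqueDiffOn_Icc hb) le_rfl
  have h_one : ∀ r : ℝ, |r| ≤ r₀ → h r = 1 := fun r hr' ↦
    h.one_of_mem_closedBall (by simpa using hr')
  have hD0 : ∀ r : ℝ, |r| < r₀ → D r = 0 := by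
    intro r hr'
    have hev : (h : ℝ → ℝ) =ᶠ[nhds r] fun _ ↦ 1 := by
      filter_upwards [(isOpen_lt continuous_abs continuous_const).mem_nhds hr'] with x hx
      exact h_one x (le_of_lt hx)
    have := (hev.filter_mono nhdsWithin_le_nhds).derivWithin_eq (s := Set.Icc (-b) b)
      hev.self_of_nhds
    rw [show D r = _ from this, derivWithin_fun_const]
    rfl
  have hsub : Set.Icc (-r₁) r₁ ⊆ Set.Icc (-b) b := Set.Icc_subset_Icc (by linarith) (by linarith)
  have hA : 0 < ∫ r in (-r₁)..r₁, c r * g r := by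
    refine intervalIntegral.integral_pos (by linarith) ((hc.mul hg).mono hsub) ?_ ?_
    · intro r hr'
      have := hsub (Set.Ioc_subset_Icc_self hr')
      exact mul_nonneg (hcpos r this).le (hgnonneg r this)
    · have h0 : (0 : ℝ) ∈ Set.Icc (-r₁) r₁ := ⟨by linarith, hr₁.le⟩
      exact ⟨0, h0, mul_pos (hcpos 0 (hsub h0)) hg0⟩
  have hB : 0 ≤ ∫ r in (-b)..b, c r ^ 3 * D r ^ 2 := by
    refine intervalIntegral.integral_nonneg hb.le fun r hr' ↦ ?_
    have := hcpos r hr'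
    positivity
  set A := ∫ r in (-r₁)..r₁, c r * g r
  set B := ∫ r in (-b)..b, c r ^ 3 * D r ^ 2 with hBdef
  refine ⟨A / (B + 1), by positivity, h, hh, h.zero_of_le_dist ?_, h.zero_of_le_dist ?_, ?_⟩
  · simpa [h] using le_abs_self b
  · simpa [h] using le_abs_self b
  intro F hF hF1 hFδ
  have hpos : ContinuousOn (fun r ↦ F r ^ 2 * c r * (g r * h r ^ 2)) (Set.Icc (-b) b) :=
    ((hF.pow 2).mul hc).mul (hg.mul (hh.continuousOn.pow 2))
  have hneg : ContinuousOn (fun r ↦ F r ^ 2 * (c r ^ 3 * D r ^ 2)) (Set.Icc (-b) b) :=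
    (hF.pow 2).mul ((hc.pow 3).mul (hD.pow 2))
  have hcD : ContinuousOn (fun r ↦ A / (B + 1) * (c r ^ 3 * D r ^ 2)) (Set.Icc (-b) b) :=
    continuousOn_const.mul ((hc.pow 3).mul (hD.pow 2))
  have hlower : A ≤ ∫ r in (-b)..b, F r ^ 2 * c r * (g r * h r ^ 2) := by
    calc A ≤ ∫ r in (-r₁)..r₁, F r ^ 2 * c r * (g r * h r ^ 2) := by
          refine intervalIntegral.integral_mono_on (by linarith)
            (((hc.mul hg).mono hsub).intervalIntegrable_of_Icc (by linarith))
            ((hpos.mono hsub).intervalIntegrable_of_Icc (by linarith)) fun r hr' ↦ ?_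
          have habs : |r| ≤ r₁ := abs_le.2 hr'
          have hcg := mul_nonneg (hcpos r (hsub hr')).le (hgnonneg r (hsub hr'))
          rw [h_one r (habs.trans hr.le)]
          nlinarith [mul_le_mul_of_nonneg_right (hF1 r habs) hcg]
      _ ≤ _ := by
          refine intervalIntegral.integral_mono_interval (by linarith) (by linarith) (by linarith)
            ?_ (hpos.intervalIntegrable_of_Icc hb.le)
          filter_upwards [MeasureTheory.ae_restrict_mem measurableSet_Ioc] with r hr'
          have hr'' := Set.Ioc_subset_Icc_self hr'
          have h1 := hcpos r hr''
          have h2 := hgnonneg r hr''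
          simp only [Pi.zero_apply]
          positivity
  have hupper : ∫ r in (-b)..b, F r ^ 2 * (c r ^ 3 * D r ^ 2) ≤ A / (B + 1) * B := by
    rw [hBdef, ← intervalIntegral.integral_const_mul]
    refine intervalIntegral.integral_mono_on hb.le (hneg.intervalIntegrable_of_Icc hb.le)
      (hcD.intervalIntegrable_of_Icc hb.le) fun r hr' ↦ ?_
    rcases lt_or_ge |r| r₀ with hlt | hge
    · simp [hD0 r hlt]
    · have := hcpos r hr'
      exact mul_le_mul_of_nonneg_right (hFδ r hge (abs_le.2 hr')) (by positivity)
  have hlt : A / (B + 1) * B < A := by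
    rw [div_mul_eq_mul_div, div_lt_iff₀ (by positivity)]
    linarith
  have hsplit : ∫ r in (-b)..b, F r ^ 2 * c r * (g r * h r ^ 2 - c r ^ 2 * D r ^ 2) =
      (∫ r in (-b)..b, F r ^ 2 * c r * (g r * h r ^ 2)) -
        ∫ r in (-b)..b, F r ^ 2 * (c r ^ 3 * D r ^ 2) := by
    rw [← intervalIntegral.integral_sub (hpos.intervalIntegrable_of_Icc hb.le)
      (hneg.intervalIntegrable_of_Icc hb.le)]
    congr 1
    ext r
    ring
  rw [hsplit]
  linarith

/-- The key step of Lemma "MC>0Mab" of the paper: given `c₁ > 0` continuous and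
`g ≥ 0` continuous with `g(0) > 0`, one can choose `r₀`, `δ`, and a `C¹` test
function `h` vanishing at `±b` such that for every zonal profile `F` with
`F² ≥ 1` on `|r| ≤ r₀` and `F² ≤ δ` on `r₀ ≤ |r| ≤ b`, the Misiołek curvature
integral `∫ F²c₁(g h² - c₁²h'²)` is positive. -/
theorem stmt_7 (b : ℝ) (hb : 0 < b) (c₁ g : ℝ → ℝ)
    (hc₁cont : ContinuousOn c₁ (Set.Icc (-b) b))
    (hc₁pos : ∀ r ∈ Set.Icc (-b) b, 0 < c₁ r)
    (hgcont : ContinuousOn g (Set.Icc (-b) b))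
    (hgnonneg : ∀ r ∈ Set.Icc (-b) b, 0 ≤ g r)
    (hg0 : 0 < g 0) :
    ∃ r₀ ∈ Set.Ioo (0 : ℝ) b, ∃ δ > (0 : ℝ), ∃ h : ℝ → ℝ,
      ContDiffOn ℝ 1 h (Set.Icc (-b) b) ∧ h (-b) = 0 ∧ h b = 0 ∧
      ∀ F : ℝ → ℝ, ContinuousOn F (Set.Icc (-b) b) →
        (∀ r : ℝ, |r| ≤ r₀ → 1 ≤ F r ^ 2) →
        (∀ r : ℝ, r₀ ≤ |r| → |r| ≤ b → F r ^ 2 ≤ δ) →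
        0 < ∫ r in (-b)..b,
              F r ^ 2 * c₁ r *
                (g r * h r ^ 2
                  - c₁ r ^ 2 * (derivWithin h (Set.Icc (-b) b) r) ^ 2) := by
  obtain ⟨δ, hδ, h, hh, hl, hr, H⟩ := exists_bump_integral_pos (r₁ := b / 4) (r₀ := b / 2)
    (by linarith) (by linarith) (by linarith) hc₁cont hc₁pos hgcont hgnonneg hg0
  exact ⟨b / 2, ⟨by linarith, by linarith⟩, δ, hδ, h, hh, hl, hr, fun F hF hF1 hFδ ↦
    H F hF (fun r hr' ↦ hF1 r (by linarith)) hFδ⟩
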